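/- arXiv:1710.05233 — 2 statements merged into one kernel-verified Lean document; each statement's English description precedes it below -/
import Mathlib

section
/- Let S = (S_1, …, S_m) be a tuple of independent random variables taking values in a finite set Z, and let h be a random variable (taking values in a finite set) jointly distributed with S. If I(h; S) ≤ d (in bits), then (1/m)·Σ_{i=1}^m √(I(h; S_i)) ≤ √(d/m). -/
open scoped Classical

/-- Shannon entropy (in bits) of a distribution given by a weight function on a finite type. -/
noncomputable def ent {α : Type*} [Fintype α] (p : α → ℝ) : ℝ :=
  - ∑ a, p a * Real.logb 2 (p a)

/-- Mutual information (in bits) between the two coordinates of a joint distribution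
given by a weight function on a finite product type. -/
noncomputable def mutInfo {α β : Type*} [Fintype α] [Fintype β] (μ : α × β → ℝ) : ℝ :=
  ent (fun a => ∑ b, μ (a, b)) + ent (fun b => ∑ a, μ (a, b)) - ent μ

/-- Gibbs' inequality. -/
lemma gibbs_inequality {α : Type*} [Fintype α] (p r : α → ℝ) (hp : ∀ a, 0 ≤ p a)
    (hr : ∀ a, 0 ≤ r a) (hpr : ∀ a, r a = 0 → p a = 0) (hsum : ∑ a, r a ≤ ∑ a, p a) :
    0 ≤ ∑ a, p a * (Real.logb 2 (p a) - Real.logb 2 (r a)) := by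
  have hterm : ∀ a, p a - r a ≤ p a * (Real.log (p a) - Real.log (r a)) := by
    intro a
    rcases (hp a).eq_or_lt with h | h
    · simp [← h, hr a]
    · have hra : 0 < r a := (hr a).lt_of_ne' fun h0 => h.ne' (hpr a h0)
      have hlog := Real.log_le_sub_one_of_pos (div_pos hra h)
      rw [Real.log_div hra.ne' h.ne'] at hlog
      have hmul := mul_le_mul_of_nonneg_left hlog h.le
      have hcancel : p a * (r a / p a - 1) = r a - p a := by field_simp
      linarith
  have hlog2 : 0 < Real.log 2 := Real.log_pos (by norm_num)
  have heq : ∑ a, p a * (Real.logb 2 (p a) - Real.logb 2 (r a))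
      = (∑ a, p a * (Real.log (p a) - Real.log (r a))) / Real.log 2 := by
    rw [Finset.sum_div]
    refine Finset.sum_congr rfl fun a _ => ?_
    simp only [Real.logb]
    ring
  rw [heq]
  refine div_nonneg ?_ hlog2.le
  have hle := Finset.sum_le_sum fun a (_ : a ∈ Finset.univ) => hterm a
  rw [Finset.sum_sub_distrib] at hle
  linarith

lemma mutInfo_eq_sum {α β : Type*} [Fintype α] [Fintype β] (μ : α × β → ℝ) :
    mutInfo μ = ∑ a, ∑ b, μ (a, b) * (Real.logb 2 (μ (a, b))
      - Real.logb 2 (∑ b', μ (a, b')) - Real.logb 2 (∑ a', μ (a', b))) := by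
  have hcomm : ∑ a, ∑ b, μ (a, b) * Real.logb 2 (∑ a', μ (a', b))
      = ∑ b, (∑ a, μ (a, b)) * Real.logb 2 (∑ a', μ (a', b)) := by
    rw [Finset.sum_comm]
    simp only [Finset.sum_mul]
  simp only [mutInfo, ent, mul_sub, Finset.sum_sub_distrib, hcomm, Fintype.sum_prod_type,
    Finset.sum_mul]
  ring

lemma mutInfo_nonneg {α β : Type*} [Fintype α] [Fintype β] (μ : α × β → ℝ)
    (hμ0 : ∀ p, 0 ≤ μ p) (hμ1 : ∑ p, μ p = 1) : 0 ≤ mutInfo μ := by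
  have hzero : ∀ p : α × β, (∑ b, μ (p.1, b)) * (∑ a, μ (a, p.2)) = 0 → μ p = 0 := by
    intro p hp
    rcases mul_eq_zero.1 hp with h | h
    · exact (Finset.sum_eq_zero_iff_of_nonneg fun b _ => hμ0 (p.1, b)).1 h p.2 (Finset.mem_univ _)
    · exact (Finset.sum_eq_zero_iff_of_nonneg fun a _ => hμ0 (a, p.2)).1 h p.1 (Finset.mem_univ _)
  have hsum : ∑ p : α × β, (∑ b, μ (p.1, b)) * (∑ a, μ (a, p.2)) = 1 := by
    rw [Fintype.sum_prod_type]
    simp only [← Finset.mul_sum]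
    rw [← Finset.sum_mul, Finset.sum_comm (f := fun b a => μ (a, b)), ← Fintype.sum_prod_type,
      hμ1, one_mul]
  have hgibbs := gibbs_inequality μ (fun p => (∑ b, μ (p.1, b)) * (∑ a, μ (a, p.2))) hμ0
    (fun p => mul_nonneg (Finset.sum_nonneg fun _ _ => hμ0 _) (Finset.sum_nonneg fun _ _ => hμ0 _))
    hzero (by rw [hsum, hμ1])
  rw [mutInfo_eq_sum, ← Fintype.sum_prod_type (f := fun p : α × β => μ p * (Real.logb 2 (μ p)
      - Real.logb 2 (∑ b', μ (p.1, b')) - Real.logb 2 (∑ a', μ (a', p.2))))]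
  refine hgibbs.trans_eq (Finset.sum_congr rfl fun p _ => ?_)
  by_cases hp : μ p = 0
  · simp [hp]
  · have hne : (∑ b, μ (p.1, b)) * (∑ a, μ (a, p.2)) ≠ 0 := fun h => hp (hzero p h)
    rw [Real.logb_mul (left_ne_zero_of_mul hne) (right_ne_zero_of_mul hne)]
    ring

/-- The joint distribution of the first component and the `i`-th coordinate of the second. -/
noncomputable def coordMarginal {H Z : Type*} [Fintype Z] {m : ℕ}
    (μ : H × (Fin m → Z) → ℝ) (i : Fin m) (p : H × Z) : ℝ :=
  ∑ s ∈ Finset.univ.filter (fun s : Fin m → Z => s i = p.2), μ (p.1, s)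

section coordMarginal

variable {H Z : Type*} [Fintype Z] {m : ℕ} (μ : H × (Fin m → Z) → ℝ)

lemma coordMarginal_nonneg (hμ0 : ∀ p, 0 ≤ μ p) (i : Fin m) (p : H × Z) :
    0 ≤ coordMarginal μ i p :=
  Finset.sum_nonneg fun _ _ => hμ0 _

lemma eq_zero_of_coordMarginal_eq_zero (hμ0 : ∀ p, 0 ≤ μ p) {i : Fin m} {h : H} {s : Fin m → Z}
    (h0 : coordMarginal μ i (h, s i) = 0) : μ (h, s) = 0 :=
  (Finset.sum_eq_zero_iff_of_nonneg fun s' _ => hμ0 (h, s')).1 h0 s (by simp)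

lemma sum_coordMarginal_mul (i : Fin m) (h : H) (g : Z → ℝ) :
    ∑ z, coordMarginal μ i (h, z) * g z = ∑ s, μ (h, s) * g (s i) := by
  rw [← Finset.sum_fiberwise (s := Finset.univ) (g := fun s : Fin m → Z => s i)]
  refine Finset.sum_congr rfl fun z _ => ?_
  rw [coordMarginal, Finset.sum_mul]
  refine Finset.sum_congr rfl fun s hs => ?_
  rw [(Finset.mem_filter.1 hs).2]

lemma sum_coordMarginal_right (i : Fin m) (h : H) :
    ∑ z, coordMarginal μ i (h, z) = ∑ s, μ (h, s) := by
  simpa using sum_coordMarginal_mul μ i h fun _ => 1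

lemma sum_coordMarginal_left [Fintype H] (q : Fin m → Z → ℝ) (hq1 : ∀ i, ∑ z, q i z = 1)
    (hind : ∀ s : Fin m → Z, (∑ h, μ (h, s)) = ∏ i, q i (s i)) (i : Fin m) (z : Z) :
    ∑ h, coordMarginal μ i (h, z) = q i z := by
  have hfilter : Finset.univ.filter (fun s : Fin m → Z => s i = z)
      = Fintype.piFinset fun j => if j = i then {z} else Finset.univ := by
    ext s
    simp only [Finset.mem_filter, Finset.mem_univ, true_and, Fintype.mem_piFinset]
    refine ⟨fun hs j => ?_, fun hs => by simpa using hs i⟩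
    split_ifs with hj
    · simp [hj, hs]
    · simp
  simp only [coordMarginal]
  rw [Finset.sum_comm, Finset.sum_congr rfl fun s _ => hind s, hfilter,
    ← Finset.prod_univ_sum, Finset.prod_eq_single i]
  · simp
  · intro j _ hj
    simp [hj, hq1]
  · simp

/-- Mutual information with a tuple of independent coordinates is superadditive. -/
lemma sum_mutInfo_coordMarginal_le [Fintype H] (hμ0 : ∀ p, 0 ≤ μ p)
    (q : Fin m → Z → ℝ) (hq1 : ∀ i, ∑ z, q i z = 1)
    (hind : ∀ s : Fin m → Z, (∑ h, μ (h, s)) = ∏ i, q i (s i)) :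
    ∑ i, mutInfo (coordMarginal μ i) ≤ mutInfo μ := by
  set P : H → ℝ := fun h => ∑ s, μ (h, s)
  have hP0 : ∀ h, 0 ≤ P h := fun h => Finset.sum_nonneg fun _ _ => hμ0 _
  have hPzero : ∀ h s, P h = 0 → μ (h, s) = 0 := fun h s h0 =>
    (Finset.sum_eq_zero_iff_of_nonneg fun s _ => hμ0 (h, s)).1 h0 s (Finset.mem_univ _)
  have hqzero : ∀ h s, ∏ i, q i (s i) = 0 → μ (h, s) = 0 := fun h s h0 =>
    (Finset.sum_eq_zero_iff_of_nonneg fun h _ => hμ0 (h, s)).1 ((hind s).trans h0) h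
      (Finset.mem_univ _)
  let ν : H × (Fin m → Z) → ℝ := fun p => P p.1 * ∏ i, coordMarginal μ i (p.1, p.2 i) / P p.1
  have hνzero : ∀ p, ν p = 0 → μ p = 0 := by
    rintro ⟨h, s⟩ h0
    rcases mul_eq_zero.1 h0 with h0 | h0
    · exact hPzero h s h0
    · obtain ⟨i, -, hi⟩ := Finset.prod_eq_zero_iff.1 h0
      rcases div_eq_zero_iff.1 hi with hi | hi
      · exact eq_zero_of_coordMarginal_eq_zero μ hμ0 hi
      · exact hPzero h s hi
  have hνsum : ∑ p, ν p = ∑ p, μ p := by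
    rw [Fintype.sum_prod_type, Fintype.sum_prod_type]
    refine Finset.sum_congr rfl fun h _ => ?_
    change ∑ s : Fin m → Z, P h * ∏ i, coordMarginal μ i (h, s i) / P h = P h
    rw [← Finset.mul_sum]
    by_cases hh : P h = 0
    · simp [hh]
    · rw [← Fintype.prod_sum (f := fun i z => coordMarginal μ i (h, z) / P h)]
      simp only [← Finset.sum_div, sum_coordMarginal_right]
      change P h * ∏ _i : Fin m, P h / P h = P h
      simp [div_self hh]
  have hgibbs := gibbs_inequality μ ν hμ0
    (fun p => mul_nonneg (hP0 _) (Finset.prod_nonneg fun i _ =>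
      div_nonneg (coordMarginal_nonneg μ hμ0 i _) (hP0 _))) hνzero hνsum.le
  have hmarg : ∀ i, mutInfo (coordMarginal μ i) = ∑ h, ∑ s, μ (h, s) *
      (Real.logb 2 (coordMarginal μ i (h, s i)) - Real.logb 2 (P h)
        - Real.logb 2 (q i (s i))) := by
    intro i
    rw [mutInfo_eq_sum]
    refine Finset.sum_congr rfl fun h _ => ?_
    simp only [sum_coordMarginal_right, sum_coordMarginal_left μ q hq1 hind]
    exact sum_coordMarginal_mul μ i h fun z =>
      Real.logb 2 (coordMarginal μ i (h, z)) - Real.logb 2 (P h) - Real.logb 2 (q i z)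
  rw [← sub_nonneg]
  refine hgibbs.trans_eq ?_
  rw [Finset.sum_congr rfl fun i _ => hmarg i, Finset.sum_comm, mutInfo_eq_sum,
    ← Finset.sum_sub_distrib, Fintype.sum_prod_type]
  refine Finset.sum_congr rfl fun h _ => ?_
  rw [Finset.sum_comm, ← Finset.sum_sub_distrib]
  refine Finset.sum_congr rfl fun s _ => ?_
  by_cases hs : μ (h, s) = 0
  · simp [hs]
  have hPne : P h ≠ 0 := fun h0 => hs (hPzero h s h0)
  have hqne : ∀ i, q i (s i) ≠ 0 := fun i h0 =>
    hs (hqzero h s (Finset.prod_eq_zero (Finset.mem_univ i) h0))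
  have hcne : ∀ i, coordMarginal μ i (h, s i) ≠ 0 := fun i h0 =>
    hs (eq_zero_of_coordMarginal_eq_zero μ hμ0 h0)
  have hlogν : Real.logb 2 (ν (h, s)) = Real.logb 2 (P h)
      + ∑ i, (Real.logb 2 (coordMarginal μ i (h, s i)) - Real.logb 2 (P h)) := by
    have hdiv : ∀ i, coordMarginal μ i (h, s i) / P h ≠ 0 := fun i => div_ne_zero (hcne i) hPne
    change Real.logb 2 (P h * ∏ i, coordMarginal μ i (h, s i) / P h) = _
    rw [Real.logb_mul hPne (Finset.prod_ne_zero_iff.2 fun i _ => hdiv i),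
      Real.logb_prod _ _ fun i _ => hdiv i]
    simp only [Real.logb_div (hcne _) hPne]
  rw [hlogν, hind, Real.logb_prod _ _ fun i _ => hqne i, ← Finset.mul_sum]
  simp only [Finset.sum_sub_distrib]
  ring

end coordMarginal

/-- Let `(h, S)` be jointly distributed with `S = (S_1, …, S_m)` having
independent coordinates (its marginal is the product of the coordinate marginals `q i`).
If `I(h; S) ≤ d` bits, then `(1/m)·Σᵢ √(I(h; Sᵢ)) ≤ √(d/m)`. -/
theorem stmt16 {H Z : Type*} [Fintype H] [Fintype Z] (m : ℕ) (d : ℝ)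
    (μ : H × (Fin m → Z) → ℝ) (hμ0 : ∀ p, 0 ≤ μ p) (hμ1 : ∑ p, μ p = 1)
    (q : Fin m → Z → ℝ) (hq0 : ∀ i z, 0 ≤ q i z) (hq1 : ∀ i, ∑ z, q i z = 1)
    (hind : ∀ s : Fin m → Z, (∑ h, μ (h, s)) = ∏ i, q i (s i))
    (hI : mutInfo μ ≤ d) :
    (1 / (m : ℝ)) * ∑ i : Fin m,
        Real.sqrt (mutInfo (fun p : H × Z =>
          ∑ s ∈ Finset.univ.filter (fun s : Fin m → Z => s i = p.2), μ (p.1, s)))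
      ≤ Real.sqrt (d / m) := by
  have hle := (sum_mutInfo_coordMarginal_le μ hμ0 q hq1 hind).trans hI
  have hnonneg : ∀ i, 0 ≤ mutInfo (coordMarginal μ i) := fun i =>
    mutInfo_nonneg _ (coordMarginal_nonneg μ hμ0 i) <| by
      rw [Fintype.sum_prod_type]
      simp only [sum_coordMarginal_right]
      rw [← Fintype.sum_prod_type, hμ1]
  change (1 / (m : ℝ)) * ∑ i, Real.sqrt (mutInfo (coordMarginal μ i)) ≤ _
  rcases Nat.eq_zero_or_pos m with rfl | hm
  · simp
  have hm' : (0 : ℝ) < m := Nat.cast_pos.2 hm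
  refine Real.le_sqrt_of_sq_le ?_
  have hcs := sq_sum_le_card_mul_sum_sq (s := Finset.univ)
    (f := fun i => Real.sqrt (mutInfo (coordMarginal μ i)))
  simp only [Real.sq_sqrt (hnonneg _), Finset.card_univ, Fintype.card_fin] at hcs
  have hbound := hcs.trans (mul_le_mul_of_nonneg_left hle hm'.le)
  calc _ = (∑ i, Real.sqrt (mutInfo (coordMarginal μ i))) ^ 2 / (m : ℝ) ^ 2 := by ring
    _ ≤ (m * d) / (m : ℝ) ^ 2 := by gcongr
    _ = d / m := by field_simp
end

section
/- Let Z = X × {0,1} be a finite example domain, D a distribution on Z, m ∈ ℕ, and A : Z^m → (probability distributions on hypotheses X → {0,1}) a randomized learning algorithm such that, for S ~ D^m and h the output of A on S, I(S; h) ≤ d (in bits). Let P_{h|S} denote the conditional output distribution of A given S. If m ≥ 5·((d+1)/ε²)·ln((d+1)/ε) for some ε > 0 with (d+1)/ε > 1, then Pr_{S~D^m}[ E_{h~P_{h|S}}[ err(h; D) − êrr(h; S) ] > ε ] < (d+1)/(m·ε²). -/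
open scoped Classical

/-- True error of a hypothesis `h : X → Bool` with respect to a distribution `D` on
`X × Bool`. -/
noncomputable def trueErr {X : Type*} [Fintype X] (D : X × Bool → ℝ) (h : X → Bool) : ℝ :=
  ∑ z, D z * (if h z.1 ≠ z.2 then (1 : ℝ) else 0)

/-- Empirical error of a hypothesis `h : X → Bool` on a sample `S` of size `m`. -/
noncomputable def empErr {X : Type*} {m : ℕ} (S : Fin m → X × Bool) (h : X → Bool) : ℝ :=
  (1 / (m : ℝ)) * ∑ i, (if h (S i).1 ≠ (S i).2 then (1 : ℝ) else 0)

/-- Hoeffding's lemma for a weight function on a finite type and a `[0, 1]`-valued variable. -/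
lemma sum_mul_exp_sub_le {α : Type*} [Fintype α] (D : α → ℝ) (hD0 : ∀ z, 0 ≤ D z)
    (hD1 : ∑ z, D z = 1) (x : α → ℝ) (hx : ∀ z, x z ∈ Set.Icc (0 : ℝ) 1) (t : ℝ) :
    ∑ z, D z * Real.exp (t * ((∑ y, D y * x y) - x z)) ≤ Real.exp (t ^ 2 / 8) := by
  let _ : MeasurableSpace α := ⊤
  have hsum : ∑ z, ENNReal.ofReal (D z) = 1 := by
    rw [← ENNReal.ofReal_sum_of_nonneg fun z _ => hD0 z, hD1, ENNReal.ofReal_one]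
  let p : PMF α := PMF.ofFintype (fun z => ENNReal.ofReal (D z)) hsum
  have hint (f : α → ℝ) : ∫ z, f z ∂p.toMeasure = ∑ z, D z * f z := by
    rw [PMF.integral_eq_sum]
    refine Finset.sum_congr rfl fun z _ => ?_
    simp [p, PMF.ofFintype_apply, ENNReal.toReal_ofReal (hD0 z)]
  have hsub := ProbabilityTheory.hasSubgaussianMGF_of_mem_Icc (μ := p.toMeasure) (X := x)
    (a := 0) (b := 1) (measurable_from_top.aemeasurable) (Filter.Eventually.of_forall hx)
  have hle := hsub.mgf_le (-t)
  rw [ProbabilityTheory.mgf, hint, hint] at hle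
  calc _ = ∑ z, D z * Real.exp (-t * (x z - ∑ y, D y * x y)) := by
        refine Finset.sum_congr rfl fun z _ => ?_
        ring_nf
    _ ≤ _ := hle
    _ = _ := by
        congr 1
        simp
        ring

/-- The mutual information of a joint distribution, given by a distribution `w` and a family `A`
of conditional distributions, is the average relative entropy to the second marginal. -/
lemma mutInfo_mul_log_two {α β : Type*} [Fintype α] [Fintype β] (w : α → ℝ)
    (A : α → β → ℝ) (hA1 : ∀ s, ∑ f, A s f = 1) :
    mutInfo (fun p : α × β => w p.1 * A p.1 p.2) * Real.log 2 =
      ∑ s, ∑ f, w s * A s f * (Real.log (A s f) - Real.log (∑ r, w r * A r f)) := by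
  have hlog : Real.log 2 ≠ 0 := (Real.log_pos one_lt_two).ne'
  have hent₁ : ent (fun s => ∑ f, w s * A s f) * Real.log 2 =
      -∑ s, ∑ f, w s * A s f * Real.log (w s) := by
    simp_rw [ent, neg_mul, Finset.sum_mul, ← Finset.mul_sum, hA1, ← Finset.sum_mul,
      ← Finset.mul_sum, hA1, Real.logb, mul_one, Finset.sum_mul]
    congr 1
    refine Finset.sum_congr rfl fun c _ => ?_
    field_simp
  have hent₂ : ent (fun f => ∑ s, w s * A s f) * Real.log 2 =
      -∑ s, ∑ f, w s * A s f * Real.log (∑ r, w r * A r f) := by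
    rw [Finset.sum_comm]
    simp_rw [ent, neg_mul, ← Finset.sum_mul, Finset.sum_mul _ _ (Real.log 2)]
    congr 1
    refine Finset.sum_congr rfl fun c _ => ?_
    rw [Real.logb]
    field_simp
  have hent₃ : ent (fun p : α × β => w p.1 * A p.1 p.2) * Real.log 2 =
      -∑ s, ∑ f, w s * A s f * Real.log (w s * A s f) := by
    rw [← Fintype.sum_prod_type' (f := fun s f => w s * A s f * Real.log (w s * A s f))]
    simp_rw [ent, neg_mul, Finset.sum_mul]
    congr 1
    refine Finset.sum_congr rfl fun c _ => ?_
    rw [Real.logb]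
    field_simp
  simp only [mutInfo]
  rw [sub_mul, add_mul, hent₁, hent₂, hent₃]
  simp_rw [← Finset.sum_neg_distrib, ← Finset.sum_add_distrib, ← Finset.sum_sub_distrib]
  refine Finset.sum_congr rfl fun s _ => Finset.sum_congr rfl fun f _ => ?_
  rcases eq_or_ne (w s) 0 with hs | hs
  · simp [hs]
  rcases eq_or_ne (A s f) 0 with hf | hf
  · simp [hf]
  rw [Real.log_mul hs hf]
  ring

/-- Pointwise form of the Donsker–Varadhan inequality. -/
lemma mul_le_mul_log_sub_log_add {a q : ℝ} (ha : 0 ≤ a) (hq : 0 ≤ q) (hac : q = 0 → a = 0)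
    (g : ℝ) : a * g ≤ a * (Real.log a - Real.log q) + (q * Real.exp g - a) := by
  rcases ha.eq_or_lt with rfl | ha'
  · simpa using mul_nonneg hq (Real.exp_pos g).le
  have hq' : 0 < q := hq.lt_of_ne fun h => ha'.ne' (hac h.symm)
  have h := Real.log_le_sub_one_of_pos (x := q * Real.exp g / a) (by positivity)
  rw [Real.log_div (by positivity) ha'.ne', Real.log_mul hq'.ne' (Real.exp_pos g).ne',
    Real.log_exp] at h
  have h2 := mul_le_mul_of_nonneg_left h ha
  have h3 : a * (q * Real.exp g / a - 1) = q * Real.exp g - a := by field_simp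
  linarith

/-- A linearized Donsker–Varadhan inequality on a finite type. -/
lemma sum_mul_le_sum_mul_log_sub_log_add {β : Type*} [Fintype β] {a q : β → ℝ}
    (ha : ∀ f, 0 ≤ a f) (ha1 : ∑ f, a f = 1) (hq : ∀ f, 0 ≤ q f) (hac : ∀ f, q f = 0 → a f = 0)
    (g : β → ℝ) : ∑ f, a f * g f ≤
      ∑ f, a f * (Real.log (a f) - Real.log (q f)) + (∑ f, q f * Real.exp (g f) - 1) := by
  rw [← ha1, ← Finset.sum_sub_distrib, ← Finset.sum_add_distrib]
  exact Finset.sum_le_sum fun f _ => mul_le_mul_log_sub_log_add (ha f) (hq f) (hac f) (g f)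

/-- The relative entropy of two distributions on a finite type is nonnegative. -/
lemma sum_mul_log_sub_log_nonneg {β : Type*} [Fintype β] {a q : β → ℝ}
    (ha : ∀ f, 0 ≤ a f) (ha1 : ∑ f, a f = 1) (hq : ∀ f, 0 ≤ q f) (hq1 : ∑ f, q f = 1)
    (hac : ∀ f, q f = 0 → a f = 0) :
    0 ≤ ∑ f, a f * (Real.log (a f) - Real.log (q f)) := by
  simpa [hq1] using sum_mul_le_sum_mul_log_sub_log_add ha ha1 hq hac 0

lemma eq_zero_of_sum_mul_eq_zero {α : Type*} [Fintype α] {w a : α → ℝ} (hw : ∀ s, 0 ≤ w s)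
    (ha : ∀ s, 0 ≤ a s) (h : ∑ s, w s * a s = 0) {s : α} (hs : w s ≠ 0) : a s = 0 :=
  (mul_eq_zero.1 ((Finset.sum_eq_zero_iff_of_nonneg
    fun r _ => mul_nonneg (hw r) (ha r)).1 h s (Finset.mem_univ s))).resolve_left hs

lemma sum_sum_mul_eq_one {α β : Type*} [Fintype α] [Fintype β] {w : α → ℝ}
    (hw1 : ∑ s, w s = 1) {A : α → β → ℝ} (hA1 : ∀ s, ∑ f, A s f = 1) :
    ∑ f, ∑ s, w s * A s f = 1 := by
  rw [Finset.sum_comm]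
  simp_rw [← Finset.mul_sum, hA1, mul_one, hw1]

lemma mutInfo_nonneg_s18 {α β : Type*} [Fintype α] [Fintype β]
    (w : α → ℝ) (hw : ∀ s, 0 ≤ w s) (hw1 : ∑ s, w s = 1)
    (A : α → β → ℝ) (hA0 : ∀ s f, 0 ≤ A s f) (hA1 : ∀ s, ∑ f, A s f = 1) :
    0 ≤ mutInfo (fun p : α × β => w p.1 * A p.1 p.2) := by
  refine nonneg_of_mul_nonneg_left ?_ (Real.log_pos one_lt_two)
  rw [mutInfo_mul_log_two w A hA1]
  refine Finset.sum_nonneg fun s _ => ?_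
  rcases eq_or_ne (w s) 0 with hs | hs
  · simp [hs]
  simp_rw [mul_assoc, ← Finset.mul_sum]
  exact mul_nonneg (hw s) (sum_mul_log_sub_log_nonneg (hA0 s) (hA1 s)
    (fun f => Finset.sum_nonneg fun r _ => mul_nonneg (hw r) (hA0 r f))
    (sum_sum_mul_eq_one hw1 hA1)
    fun f hf => eq_zero_of_sum_mul_eq_zero hw (fun r => hA0 r f) hf hs)

/-- Change of measure: if `exp (g · f)` has mean at most one under `w` for every `f`, then the
probability that the conditional mean of `g s` under `A s` is at least `c` is controlled by the
mutual information. -/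
lemma mul_sum_le_mutInfo_mul_log_two_add_one {α β : Type*} [Fintype α] [Fintype β]
    (w : α → ℝ) (hw : ∀ s, 0 ≤ w s) (hw1 : ∑ s, w s = 1)
    (A : α → β → ℝ) (hA0 : ∀ s f, 0 ≤ A s f) (hA1 : ∀ s, ∑ f, A s f = 1)
    (g : α → β → ℝ) (hg : ∀ f, ∑ s, w s * Real.exp (g s f) ≤ 1)
    (E : Finset α) (c : ℝ) (hE : ∀ s ∈ E, c ≤ ∑ f, A s f * g s f) :
    c * ∑ s ∈ E, w s ≤ mutInfo (fun p : α × β => w p.1 * A p.1 p.2) * Real.log 2 + 1 := by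
  set Q : β → ℝ := fun f => ∑ r, w r * A r f with hQ
  have hQ0 : ∀ f, 0 ≤ Q f := fun f => Finset.sum_nonneg fun r _ => mul_nonneg (hw r) (hA0 r f)
  have hQ1 : ∑ f, Q f = 1 := sum_sum_mul_eq_one hw1 hA1
  have hac (s : α) (hs : w s ≠ 0) (f : β) (hf : Q f = 0) : A s f = 0 :=
    eq_zero_of_sum_mul_eq_zero hw (fun r => hA0 r f) hf hs
  set K : α → ℝ := fun s => ∑ f, A s f * (Real.log (A s f) - Real.log (Q f)) with hK
  have hDV (s : α) (hs : w s ≠ 0) (u : β → ℝ) : ∑ f, A s f * u f ≤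
      K s + (∑ f, Q f * Real.exp (u f) - 1) :=
    sum_mul_le_sum_mul_log_sub_log_add (hA0 s) (hA1 s) hQ0 (hac s hs) u
  have hK0 (s : α) (hs : w s ≠ 0) : 0 ≤ K s :=
    sum_mul_log_sub_log_nonneg (hA0 s) (hA1 s) hQ0 hQ1 (hac s hs)
  have hB0 (s : α) : 0 ≤ ∑ f, Q f * Real.exp (g s f) :=
    Finset.sum_nonneg fun f _ => mul_nonneg (hQ0 f) (Real.exp_pos _).le
  calc c * ∑ s ∈ E, w s = ∑ s ∈ E, w s * c := by rw [mul_comm, Finset.sum_mul]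
    _ ≤ ∑ s ∈ E, w s * (K s + ∑ f, Q f * Real.exp (g s f)) := by
        refine Finset.sum_le_sum fun s hs => ?_
        rcases eq_or_ne (w s) 0 with h0 | h0
        · simp [h0]
        · exact mul_le_mul_of_nonneg_left (by linarith [hE s hs, hDV s h0 (g s)]) (hw s)
    _ ≤ ∑ s, w s * (K s + ∑ f, Q f * Real.exp (g s f)) := by
        refine Finset.sum_le_sum_of_subset_of_nonneg (Finset.subset_univ E) fun s _ _ => ?_
        rcases eq_or_ne (w s) 0 with h0 | h0
        · simp [h0]
        · exact mul_nonneg (hw s) (add_nonneg (hK0 s h0) (hB0 s))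
    _ = ∑ s, w s * K s + ∑ f, Q f * ∑ s, w s * Real.exp (g s f) := by
        simp_rw [mul_add, Finset.sum_add_distrib, Finset.mul_sum]
        congr 1
        rw [Finset.sum_comm]
        refine Finset.sum_congr rfl fun f _ => Finset.sum_congr rfl fun s _ => ?_
        ring
    _ ≤ ∑ s, w s * K s + ∑ f, Q f * 1 := by
        gcongr with f _
        · exact hQ0 f
        · exact hg f
    _ = _ := by
        rw [mutInfo_mul_log_two w A hA1]
        simp_rw [mul_one, hQ1, hK, hQ, Finset.mul_sum, mul_assoc]

/-- Exponential moment of the generalization gap of a fixed hypothesis. -/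
lemma sum_prod_mul_exp_gap_le_one {X : Type*} [Fintype X] {m : ℕ} (hm : 0 < m)
    (D : X × Bool → ℝ) (hD0 : ∀ z, 0 ≤ D z) (hD1 : ∑ z, D z = 1) (h : X → Bool) (ε : ℝ) :
    ∑ s : Fin m → X × Bool, (∏ i, D (s i)) *
      Real.exp (4 * m * ε * (trueErr D h - empErr s h) - 2 * m * ε ^ 2) ≤ 1 := by
  set x : X × Bool → ℝ := fun z => if h z.1 ≠ z.2 then (1 : ℝ) else 0 with hx
  have hx01 : ∀ z, x z ∈ Set.Icc (0 : ℝ) 1 := by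
    intro z
    simp only [hx]
    split_ifs <;> simp
  have hm' : (m : ℝ) ≠ 0 := by positivity
  have hterm (s : Fin m → X × Bool) : (∏ i, D (s i)) *
      Real.exp (4 * m * ε * (trueErr D h - empErr s h) - 2 * m * ε ^ 2) =
      ∏ i, (D (s i) * Real.exp (4 * ε * ((∑ y, D y * x y) - x (s i)) - 2 * ε ^ 2)) := by
    rw [Finset.prod_mul_distrib, ← Real.exp_sum]
    congr 2
    rw [Finset.sum_sub_distrib, ← Finset.mul_sum, Finset.sum_sub_distrib]
    simp only [trueErr, empErr, hx, Finset.sum_const, Finset.card_univ, Fintype.card_fin,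
      nsmul_eq_mul]
    field_simp
  simp_rw [hterm]
  rw [← Fintype.sum_pow (fun z => D z * Real.exp (4 * ε * ((∑ y, D y * x y) - x z) - 2 * ε ^ 2))]
  refine pow_le_one₀ (Finset.sum_nonneg fun z _ => mul_nonneg (hD0 z) (Real.exp_pos _).le) ?_
  have hH := sum_mul_exp_sub_le D hD0 hD1 x hx01 (4 * ε)
  simp_rw [Real.exp_sub, ← mul_div_assoc]
  rw [← Finset.sum_div, div_le_one (Real.exp_pos _)]
  refine hH.trans_eq ?_
  congr 1
  ring

/-- **PAC-Bayes version.** If the randomized learner `A` satisfies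
`I(S; h) ≤ d` for `S ~ D^m`, and `m ≥ 5·((d+1)/ε²)·ln((d+1)/ε)` with `ε > 0` and
`(d+1)/ε > 1`, then the probability over `S ~ D^m` that the expected (over `h ~ P_{h|S}`)
generalization gap exceeds `ε` is less than `(d+1)/(mε²)`. -/
theorem stmt18 {X : Type*} [Fintype X] [DecidableEq X] (m : ℕ) (d : ℝ)
    (D : X × Bool → ℝ) (hD0 : ∀ z, 0 ≤ D z) (hD1 : ∑ z, D z = 1)
    (A : (Fin m → X × Bool) → ((X → Bool) → ℝ))
    (hA : ∀ s, (∀ f, 0 ≤ A s f) ∧ ∑ f, A s f = 1)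
    (hI : mutInfo (fun p : (Fin m → X × Bool) × (X → Bool) =>
        (∏ i, D (p.1 i)) * A p.1 p.2) ≤ d)
    (ε : ℝ) (hε : 0 < ε) (hdε : 1 < (d + 1) / ε)
    (hm : 5 * ((d + 1) / ε ^ 2) * Real.log ((d + 1) / ε) ≤ (m : ℝ)) :
    ∑ s ∈ Finset.univ.filter
        (fun s : Fin m → X × Bool =>
          ε < ∑ f, A s f * (trueErr D f - empErr s f)),
        (∏ i, D (s i))
      < (d + 1) / ((m : ℝ) * ε ^ 2) := by
  have hd : 0 < d + 1 := by
    have := (one_lt_div hε).1 hdε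
    linarith
  have hm0 : 0 < (m : ℝ) :=
    lt_of_lt_of_le (mul_pos (by positivity) (Real.log_pos hdε)) hm
  have hw0 (s : Fin m → X × Bool) : 0 ≤ ∏ i, D (s i) := Finset.prod_nonneg fun i _ => hD0 (s i)
  have hw1 : ∑ s : Fin m → X × Bool, ∏ i, D (s i) = 1 := by
    rw [← Fintype.sum_pow, hD1, one_pow]
  have hmain := mul_sum_le_mutInfo_mul_log_two_add_one (fun s : Fin m → X × Bool => ∏ i, D (s i)) hw0 hw1
    A (fun s => (hA s).1) (fun s => (hA s).2)
    (fun s f => 4 * m * ε * (trueErr D f - empErr s f) - 2 * m * ε ^ 2)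
    (fun f => sum_prod_mul_exp_gap_le_one (Nat.cast_pos.1 hm0) D hD0 hD1 f ε)
    (Finset.univ.filter (fun s : Fin m → X × Bool =>
      ε < ∑ f, A s f * (trueErr D f - empErr s f))) (2 * m * ε ^ 2) (by
      intro s hs
      have hs' := (Finset.mem_filter.1 hs).2
      have heq : ∑ f, A s f * (4 * m * ε * (trueErr D f - empErr s f) - 2 * m * ε ^ 2) =
          4 * m * ε * ∑ f, A s f * (trueErr D f - empErr s f) - 2 * m * ε ^ 2 := by
        simp_rw [mul_sub (A s _) (4 * m * ε * _), Finset.sum_sub_distrib, ← Finset.sum_mul,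
          (hA s).2, one_mul, Finset.mul_sum]
        congr 1
        exact Finset.sum_congr rfl fun f _ => by ring
      rw [heq]
      have := mul_le_mul_of_nonneg_left hs'.le (by positivity : 0 ≤ 4 * m * ε)
      linarith [sq ε])
  have hlog0 : 0 < Real.log 2 := Real.log_pos one_lt_two
  have hlog1 : Real.log 2 < 1 := by linarith [Real.log_two_lt_d9]
  have hId := mul_le_mul_of_nonneg_right hI hlog0.le
  have hd0 : 0 ≤ d := (mutInfo_nonneg_s18 (fun s : Fin m → X × Bool => ∏ i, D (s i)) hw0 hw1
    A (fun s => (hA s).1) (fun s => (hA s).2)).trans hI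
  rw [lt_div_iff₀ (by positivity)]
  nlinarith [mul_le_mul_of_nonneg_left hlog1.le hd0]
end
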